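/- Let M be a topological space, 𝓕 ⊆ C^0(M, ℝ) a C∞-subring (closed under composition with smooth functions ℝᵏ → ℝ), and 𝓣 the topology on M. Then 𝓣 is the smallest topology making all functions in 𝓕 continuous if and only if 𝓣 is 𝓕-regular, i.e., for every 𝓣-closed set C and point x ∉ C there is a function ρ ∈ 𝓕 with values in [0,1], support contained in M∖C, and ρ identically 1 on a neighborhood of x. -/

import Mathlib

/-- A family `F` of real-valued functions is closed under composition with smooth
functions `ℝᵏ → ℝ` (in particular `F` is a `C∞`-ring of functions). -/
def SmoothClosed {X : Type} (F : Set (X → ℝ)) : Prop :=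
  ∀ (k : ℕ) (h : (Fin k → ℝ) → ℝ), ContDiff ℝ (⊤ : ℕ∞) h →
    ∀ a : Fin k → (X → ℝ), (∀ i, a i ∈ F) → (fun m => h fun i => a i m) ∈ F

/-- A `C∞`-derivation of the `C∞`-ring of functions `F`: `w` maps `F` to `F` and
satisfies the chain rule `w (h∘(a₁,…,aₖ)) = Σᵢ (∂ᵢh)∘(a₁,…,aₖ) · w(aᵢ)` for all smooth
`h : ℝᵏ → ℝ` and all `a₁,…,aₖ ∈ F`. -/
def IsCInfDerF {X : Type} (F : Set (X → ℝ)) (w : (X → ℝ) → (X → ℝ)) : Prop :=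
  (∀ f ∈ F, w f ∈ F) ∧
  ∀ (k : ℕ) (h : (Fin k → ℝ) → ℝ), ContDiff ℝ (⊤ : ℕ∞) h →
    ∀ a : Fin k → (X → ℝ), (∀ i, a i ∈ F) →
      w (fun m => h fun i => a i m)
        = fun m => ∑ i, fderiv ℝ h (fun j => a j m) (Pi.single i 1) * w (a i) m

/-- `F`-regularity of the topology on `M`: for every closed set `C` and point `x ∉ C`
there is a bump function `ρ ∈ F` with values in `[0,1]`, support (closure of `ρ ≠ 0`)
disjoint from `C`, and identically `1` on a neighborhood of `x`. -/
def FRegular {M : Type} [TopologicalSpace M] (F : Set (M → ℝ)) : Prop :=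
  ∀ C : Set M, IsClosed C → ∀ x ∉ C, ∃ ρ ∈ F,
    (∀ y, ρ y ∈ Set.Icc (0 : ℝ) 1) ∧
    closure {y | ρ y ≠ 0} ∩ C = ∅ ∧
    ∀ᶠ y in nhds x, ρ y = 1

/-- for a topological space `M` with topology `t` and a `C∞`-subring
`F ⊆ C⁰(M, ℝ)` of continuous functions, `t` is the smallest topology making all
functions in `F` continuous if and only if `t` is `F`-regular. -/
theorem smallest_topology_iff_FRegular {M : Type} [t : TopologicalSpace M]
    (F : Set (M → ℝ))
    (hcont : ∀ f ∈ F, Continuous f)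
    (hsm : SmoothClosed F) :
    t = ⨅ f ∈ F, TopologicalSpace.induced f inferInstance ↔ FRegular F := by
  have hn : ∀ x : M, @nhds M (⨅ f ∈ F, TopologicalSpace.induced f inferInstance) x
      = ⨅ f ∈ F, Filter.comap f (nhds (f x)) := by
    intro x
    simp only [nhds_iInf, nhds_induced]
  constructor
  · intro ht C hC x hx
    have hnx : nhds x = ⨅ f ∈ F, Filter.comap f (nhds (f x)) := by
      rw [← hn x, ← ht]
    let G : Filter M :=
      { sets := {U | ∃ ρ ∈ F, (∀ y, ρ y ∈ Set.Icc (0 : ℝ) 1) ∧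
          closure {y | ρ y ≠ 0} ⊆ U ∧ ∀ᶠ y in nhds x, ρ y = 1}
        univ_sets := by
          refine ⟨fun _ => 1, ?_, ?_, Set.subset_univ _, ?_⟩
          · exact hsm 0 (fun _ => 1) contDiff_const (fun i => i.elim0) (fun i => i.elim0)
          · intro y; simp
          · simp
        sets_of_superset := by
          rintro U V ⟨ρ, h1, h2, h3, h4⟩ hUV
          exact ⟨ρ, h1, h2, h3.trans hUV, h4⟩
        inter_sets := by
          rintro U V ⟨ρ, h1, h2, h3, h4⟩ ⟨σ, g1, g2, g3, g4⟩
          refine ⟨fun y => ρ y * σ y, ?_, ?_, ?_, ?_⟩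
          · have := hsm 2 (fun v => v 0 * v 1) (by fun_prop) ![ρ, σ]
              (by intro i; fin_cases i <;> simp [h1, g1])
            simpa using this
          · intro y
            exact ⟨mul_nonneg (h2 y).1 (g2 y).1, mul_le_one₀ (h2 y).2 (g2 y).1 (g2 y).2⟩
          · refine Set.subset_inter ((closure_mono ?_).trans h3) ((closure_mono ?_).trans g3)
            · intro y hy
              exact left_ne_zero_of_mul hy
            · intro y hy
              exact right_ne_zero_of_mul hy
          · filter_upwards [h4, g4] with y a b
            simp [a, b] }
    have hG : G ≤ nhds x := by
      rw [hnx]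
      refine le_iInf₂ fun f hf => ?_
      intro U hU
      obtain ⟨V, hV, hVU⟩ := Filter.mem_comap.1 hU
      obtain ⟨ε, hε, hb⟩ := Metric.mem_nhds_iff.1 hV
      let g : ContDiffBump (f x) := ⟨ε / 3, ε / 2, by positivity, by linarith⟩
      refine ⟨fun y => g (f y), ?_, ?_, ?_, ?_⟩
      · exact hsm 1 (fun v => g (v 0)) (g.contDiff.comp (contDiff_apply ℝ ℝ (0 : Fin 1)))
          (fun _ => f) (fun _ => hf)
      · intro y
        exact ⟨g.nonneg, g.le_one⟩
      · have hcl : IsClosed (f ⁻¹' Metric.closedBall (f x) (ε / 2)) :=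
          Metric.isClosed_closedBall.preimage (hcont f hf)
        refine (closure_minimal ?_ hcl).trans (subset_trans ?_ hVU)
        · intro y hy
          have h5 : f y ∈ Function.support g := hy
          rw [g.support_eq] at h5
          exact Metric.ball_subset_closedBall h5
        · exact Set.preimage_mono
            ((Metric.closedBall_subset_ball (by linarith)).trans hb)
      · exact (hcont f hf).continuousAt.eventually g.eventuallyEq_one
    obtain ⟨ρ, h1, h2, h3, h4⟩ := hG (hC.isOpen_compl.mem_nhds hx)
    exact ⟨ρ, h1, h2, Set.disjoint_iff_inter_eq_empty.1
      (Set.subset_compl_iff_disjoint_right.1 h3), h4⟩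
  · intro h
    apply le_antisymm
    · exact le_iInf₂ fun f hf => continuous_iff_le_induced.1 (hcont f hf)
    · refine le_of_nhds_le_nhds fun x => ?_
      rw [hn x]
      intro U hU
      obtain ⟨W, hWU, hW, hxW⟩ := mem_nhds_iff.1 hU
      obtain ⟨ρ, h1, h2, h3, h4⟩ := h Wᶜ hW.isClosed_compl x (by simpa using hxW)
      refine (iInf₂_le ρ h1 : _ ≤ Filter.comap ρ (nhds (ρ x))) ?_
      refine Filter.mem_comap.2 ⟨{0}ᶜ, ?_, ?_⟩
      · rw [h4.self_of_nhds]
        exact isOpen_compl_singleton.mem_nhds (by simp)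
      · intro y hy
        apply hWU
        by_contra hyW
        have h6 : y ∈ closure {y | ρ y ≠ 0} ∩ Wᶜ := ⟨subset_closure hy, hyW⟩
        rw [h3] at h6
        exact h6
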